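/- For every n ∈ ℤ∖{0}: (i) for every f ∈ 𝒞, L_{n,−}^{−1}f ∈ 𝒞 with lim_{β→0+} L_{n,−}^{−1}f(β) = f(0)/(2μ − 1 − |n|μ) and lim_{β→∞} L_{n,−}^{−1}f(β) = 0; (ii) there is a constant C = C(μ, δ, η), independent of n, such that for every f ∈ 𝒞^δ, L_{n,−}^{−1}f ∈ 𝒞^δ_0 and ‖L_{n,−}^{−1}f‖_{𝒞^δ} ≤ C|n|^{−1}‖f‖_{𝒞^δ}. -/

import Mathlib

open Filter Topology Set MeasureTheory intervalIntegral

/-- sup norm over `[0,∞)`. -/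
noncomputable def supN (f : ℝ → ℂ) : ℝ := ⨆ β : Ici (0 : ℝ), ‖f (β : ℝ)‖

/-- sup norm over `(0,∞)`. -/
noncomputable def supNIoi (f : ℝ → ℂ) : ℝ := ⨆ β : Ioi (0 : ℝ), ‖f (β : ℝ)‖

/-- weighted seminorm `sup_{β>0} β^δ ‖f(β) − L‖`. -/
noncomputable def hoel (δ : ℝ) (f : ℝ → ℂ) (L : ℂ) : ℝ :=
  ⨆ β : Ioi (0 : ℝ), (β : ℝ) ^ δ * ‖f (β : ℝ) - L‖

/-- `a_n(β) = √(n²μ² − (2μ−1)η(β))`. -/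
noncomputable def aFun (μ : ℝ) (η : ℝ → ℝ) (n : ℤ) (β : ℝ) : ℝ :=
  Real.sqrt ((n : ℝ) ^ 2 * μ ^ 2 - (2 * μ - 1) * η β)

/-- `W_n(β) = exp(∫_1^β a_n(b)/b db)`. -/
noncomputable def WFun (μ : ℝ) (η : ℝ → ℝ) (n : ℤ) (β : ℝ) : ℝ :=
  Real.exp (∫ b in (1 : ℝ)..β, aFun μ η n b / b)

/-- `L_{n,-}^{-1}`: for `|n| ≥ 2`,
`L_{n,-}^{-1} f (β) = −β^{2μ-1} W_n(β)^{-1} ∫_0^β b^{-2μ} W_n(b) e^{in(β-b)} f(b) db`;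
for `|n| = 1`,
`L_{n,-}^{-1} f (β) = β^{2μ-1} W_n(β)^{-1} ∫_β^∞ b^{-2μ} W_n(b) e^{in(β-b)} f(b) db`. -/
noncomputable def Lminus (μ : ℝ) (η : ℝ → ℝ) (n : ℤ) (f : ℝ → ℂ) (β : ℝ) : ℂ :=
  if 2 ≤ |n| then
    -(((β ^ (2 * μ - 1) / WFun μ η n β : ℝ) : ℂ) *
      ∫ b in (0 : ℝ)..β, ((b ^ (-(2 * μ)) * WFun μ η n b : ℝ) : ℂ) *
        Complex.exp (Complex.I * (n : ℂ) * ((β : ℂ) - (b : ℂ))) * f b)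
  else
    ((β ^ (2 * μ - 1) / WFun μ η n β : ℝ) : ℂ) *
      ∫ b in Ioi β, ((b ^ (-(2 * μ)) * WFun μ η n b : ℝ) : ℂ) *
        Complex.exp (Complex.I * (n : ℂ) * ((β : ℂ) - (b : ℂ))) * f b

lemma continuous_aFun {μ : ℝ} {η : ℝ → ℝ} (hη : Continuous η) (n : ℤ) :
    Continuous (aFun μ η n) := by
  unfold aFun
  fun_prop

lemma aFun_le {μ : ℝ} {η : ℝ → ℝ} (hμ : 1 < μ) {b : ℝ} (hb : 0 ≤ η b) (n : ℤ) :
    aFun μ η n b ≤ |(n : ℝ)| * μ := by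
  rw [aFun]
  apply Real.sqrt_le_iff.2 ⟨by positivity, ?_⟩
  rw [mul_pow, sq_abs]
  nlinarith

lemma le_aFun {μ : ℝ} {η : ℝ → ℝ} (hμ : 1 < μ) {b : ℝ} (hb : η b ≤ 1) (n : ℤ) :
    Real.sqrt ((n : ℝ) ^ 2 * μ ^ 2 - (2 * μ - 1)) ≤ aFun μ η n b := by
  rw [aFun]
  apply Real.sqrt_le_sqrt
  nlinarith

lemma aFun_of_eq_zero {μ : ℝ} {η : ℝ → ℝ} (hμ : 1 < μ) {b : ℝ} (hb : η b = 0) (n : ℤ) :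
    aFun μ η n b = |(n : ℝ)| * μ := by
  rw [aFun, hb, mul_zero, sub_zero, ← mul_pow, Real.sqrt_sq_eq_abs, abs_mul,
    abs_of_pos (by linarith : 0 < μ)]

lemma WFun_pos (μ : ℝ) (η : ℝ → ℝ) (n : ℤ) (b : ℝ) : 0 < WFun μ η n b := Real.exp_pos _

lemma hasDerivAt_WFun {μ : ℝ} {η : ℝ → ℝ} (hη : Continuous η) (n : ℤ) {b : ℝ} (hb : 0 < b) :
    HasDerivAt (WFun μ η n) (WFun μ η n b * (aFun μ η n b / b)) b := by
  have hc : ContinuousOn (fun x => aFun μ η n x / x) (Ioi 0) :=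
    (continuous_aFun hη n).continuousOn.div continuousOn_id fun x hx => (ne_of_gt hx)
  have hsub : uIcc 1 b ⊆ Ioi (0 : ℝ) := by
    intro x hx
    rw [mem_uIcc] at hx
    rw [mem_Ioi]
    rcases hx with hx | hx <;> linarith
  exact (intervalIntegral.integral_hasDerivAt_right ((hc.mono hsub).intervalIntegrable)
    (hc.stronglyMeasurableAtFilter isOpen_Ioi b hb)
    (hc.continuousAt (Ioi_mem_nhds hb))).exp

lemma WFun_of_le_one {μ : ℝ} {η : ℝ → ℝ} (hμ : 1 < μ) (hη0 : ∀ β : ℝ, β ≤ 1 → η β = 0) (n : ℤ)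
    {b : ℝ} (hb : 0 < b) (hb1 : b ≤ 1) : WFun μ η n b = b ^ (|(n : ℝ)| * μ) := by
  have h : ∫ x in (1 : ℝ)..b, aFun μ η n x / x = ∫ x in (1 : ℝ)..b, |(n : ℝ)| * μ * (1 / x) := by
    apply intervalIntegral.integral_congr
    intro x hx
    rw [uIcc_of_ge hb1] at hx
    simp only
    rw [aFun_of_eq_zero hμ (hη0 x hx.2)]
    ring
  rw [WFun, h, intervalIntegral.integral_const_mul, integral_one_div, div_one,
    Real.rpow_def_of_pos hb, mul_comm]
  rw [uIcc_of_ge hb1]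
  exact fun h0 => absurd h0.1 (not_le.2 hb)

/-- The weight `b^{-2μ} W_n(b)` in the integral defining `L_{n,-}^{-1}`. -/
noncomputable def weightFun (μ : ℝ) (η : ℝ → ℝ) (n : ℤ) (b : ℝ) : ℝ :=
  b ^ (-(2 * μ)) * WFun μ η n b

lemma weightFun_pos (μ : ℝ) (η : ℝ → ℝ) (n : ℤ) {b : ℝ} (hb : 0 < b) :
    0 < weightFun μ η n b :=
  mul_pos (Real.rpow_pos_of_pos hb _) (WFun_pos μ η n b)

lemma hasDerivAt_weightFun {μ : ℝ} {η : ℝ → ℝ} (hη : Continuous η) (n : ℤ) {b : ℝ} (hb : 0 < b) :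
    HasDerivAt (weightFun μ η n) (weightFun μ η n b * (aFun μ η n b - 2 * μ) / b) b := by
  refine ((Real.hasDerivAt_rpow_const (p := -(2 * μ)) (Or.inl hb.ne')).fun_mul
    (hasDerivAt_WFun (μ := μ) hη n hb)).congr_deriv ?_
  rw [weightFun, Real.rpow_sub_one hb.ne']
  field_simp
  ring

lemma weightFun_of_le_one {μ : ℝ} {η : ℝ → ℝ} (hμ : 1 < μ) (hη0 : ∀ β : ℝ, β ≤ 1 → η β = 0)
    (n : ℤ) {b : ℝ} (hb : 0 < b) (hb1 : b ≤ 1) :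
    weightFun μ η n b = b ^ (|(n : ℝ)| * μ - 2 * μ) := by
  rw [weightFun, WFun_of_le_one hμ hη0 n hb hb1, ← Real.rpow_add hb]
  ring_nf

lemma hasDerivAt_weightFun_mul_rpow {μ : ℝ} {η : ℝ → ℝ} (hη : Continuous η) (n : ℤ) (e : ℝ)
    {b : ℝ} (hb : 0 < b) :
    HasDerivAt (fun x => weightFun μ η n x * x ^ (1 - e))
      (weightFun μ η n b * b ^ (-e) * (aFun μ η n b + 1 - 2 * μ - e)) b := by
  refine ((hasDerivAt_weightFun (μ := μ) hη n hb).fun_mul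
    (Real.hasDerivAt_rpow_const (p := 1 - e) (Or.inl hb.ne'))).congr_deriv ?_
  rw [show 1 - e - 1 = -e by ring, Real.rpow_sub hb, Real.rpow_one, Real.rpow_neg hb.le]
  field_simp
  ring

lemma weightFun_div_le {μ e β t : ℝ} {η : ℝ → ℝ} {n : ℤ} (hβ : 0 < β) (ht : 0 < t)
    (h : weightFun μ η n (β * t) * (β * t) ^ (1 - e) ≤ weightFun μ η n β * β ^ (1 - e)) :
    weightFun μ η n (β * t) / weightFun μ η n β ≤ t ^ (e - 1) := by
  rw [Real.mul_rpow hβ.le ht.le] at h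
  have h1 : weightFun μ η n (β * t) * t ^ (1 - e) ≤ weightFun μ η n β := by
    refine le_of_mul_le_mul_right ?_ (Real.rpow_pos_of_pos hβ (1 - e))
    linarith
  rw [div_le_iff₀ (weightFun_pos μ η n hβ), show e - 1 = -(1 - e) by ring, Real.rpow_neg ht.le]
  have := Real.rpow_pos_of_pos ht (1 - e)
  field_simp
  linarith

lemma weightFun_div_le_of_le_one {μ e : ℝ} {η : ℝ → ℝ} (hη : Continuous η) {n : ℤ}
    (he : ∀ b, e ≤ aFun μ η n b + 1 - 2 * μ) {β t : ℝ} (hβ : 0 < β) (ht : 0 < t) (ht1 : t ≤ 1) :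
    weightFun μ η n (β * t) / weightFun μ η n β ≤ t ^ (e - 1) := by
  have hd := fun x (hx : x ∈ Ioi (0 : ℝ)) => hasDerivAt_weightFun_mul_rpow (μ := μ) hη n e hx
  have hmono : MonotoneOn (fun x => weightFun μ η n x * x ^ (1 - e)) (Ioi 0) := by
    apply monotoneOn_of_deriv_nonneg (convex_Ioi 0)
    · exact fun x hx => (hd x hx).continuousAt.continuousWithinAt
    · rw [interior_Ioi]
      exact fun x hx => (hd x hx).differentiableAt.differentiableWithinAt
    · rw [interior_Ioi]
      intro x hx
      rw [(hd x hx).deriv]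
      exact mul_nonneg (mul_nonneg (weightFun_pos μ η n hx).le (Real.rpow_nonneg (le_of_lt hx) _))
        (by linarith [he x])
  exact weightFun_div_le hβ ht (hmono (mul_pos hβ ht) hβ (by nlinarith))

lemma weightFun_div_le_of_one_le {μ e : ℝ} {η : ℝ → ℝ} (hη : Continuous η) {n : ℤ}
    (he : ∀ b, aFun μ η n b + 1 - 2 * μ ≤ e) {β t : ℝ} (hβ : 0 < β) (ht : 1 ≤ t) :
    weightFun μ η n (β * t) / weightFun μ η n β ≤ t ^ (e - 1) := by
  have ht0 : 0 < t := by linarith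
  have hd := fun x (hx : x ∈ Ioi (0 : ℝ)) => hasDerivAt_weightFun_mul_rpow (μ := μ) hη n e hx
  have hanti : AntitoneOn (fun x => weightFun μ η n x * x ^ (1 - e)) (Ioi 0) := by
    apply antitoneOn_of_deriv_nonpos (convex_Ioi 0)
    · exact fun x hx => (hd x hx).continuousAt.continuousWithinAt
    · rw [interior_Ioi]
      exact fun x hx => (hd x hx).differentiableAt.differentiableWithinAt
    · rw [interior_Ioi]
      intro x hx
      rw [(hd x hx).deriv]
      exact mul_nonpos_of_nonneg_of_nonpos
        (mul_nonneg (weightFun_pos μ η n hx).le (Real.rpow_nonneg (le_of_lt hx) _))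
        (by linarith [he x])
  exact weightFun_div_le hβ ht0 (hanti hβ (mul_pos hβ ht0) (by nlinarith))

/-- A positive weight `w` whose rescaled quotients `w (β t) / w β` are dominated on `T ⊆ (0,∞)`
by the integrable power `t ^ (e - 1)`, uniformly in `β > 0`. -/
structure IsPowerDominated (w : ℝ → ℝ) (T : Set ℝ) (e : ℝ) : Prop where
  measurableSet : MeasurableSet T
  subset : T ⊆ Ioi 0
  continuousOn : ContinuousOn w (Ioi 0)
  pos : ∀ b, 0 < b → 0 < w b
  div_le : ∀ β, 0 < β → ∀ t ∈ T, w (β * t) / w β ≤ t ^ (e - 1)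
  integrableOn : IntegrableOn (fun t : ℝ => t ^ (e - 1)) T

/-- The kernel `w (β t) / w β * e^{in(β - β t)}`. -/
noncomputable def oscKernel (w : ℝ → ℝ) (n : ℤ) (β t : ℝ) : ℂ :=
  ((w (β * t) / w β : ℝ) : ℂ) *
    Complex.exp (Complex.I * (n : ℂ) * ((β : ℂ) - ((β * t : ℝ) : ℂ)))

/-- The integral operator on `T` with kernel `oscKernel`, in scale-invariant form. -/
noncomputable def oscOp (w : ℝ → ℝ) (T : Set ℝ) (n : ℤ) (f : ℝ → ℂ) (β : ℝ) : ℂ :=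
  ∫ t in T, oscKernel w n β t * f (β * t)

lemma norm_exp_I_mul_int_mul (n : ℤ) (x y : ℝ) :
    ‖Complex.exp (Complex.I * (n : ℂ) * ((x : ℂ) - (y : ℂ)))‖ = 1 := by
  rw [show Complex.I * (n : ℂ) * ((x : ℂ) - (y : ℂ)) = ((n * (x - y) : ℝ) : ℂ) * Complex.I by
    push_cast; ring]
  exact Complex.norm_exp_ofReal_mul_I _

namespace IsPowerDominated

variable {w : ℝ → ℝ} {T : Set ℝ} {e : ℝ}

lemma norm_oscKernel (hw : IsPowerDominated w T e) (n : ℤ) {β t : ℝ} (hβ : 0 < β) (ht : 0 < t) :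
    ‖oscKernel w n β t‖ = w (β * t) / w β := by
  rw [oscKernel, norm_mul, norm_exp_I_mul_int_mul, mul_one, Complex.norm_real, Real.norm_eq_abs,
    abs_of_pos (div_pos (hw.pos _ (mul_pos hβ ht)) (hw.pos _ hβ))]

lemma norm_oscKernel_le (hw : IsPowerDominated w T e) (n : ℤ) {β t : ℝ} (hβ : 0 < β)
    (ht : t ∈ T) : ‖oscKernel w n β t‖ ≤ t ^ (e - 1) :=
  (hw.norm_oscKernel n hβ (hw.subset ht)).trans_le (hw.div_le β hβ t ht)

lemma continuousOn_oscKernel (hw : IsPowerDominated w T e) (n : ℤ) :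
    ContinuousOn (fun p : ℝ × ℝ => oscKernel w n p.1 p.2) (Ioi 0 ×ˢ Ioi 0) := by
  unfold oscKernel
  refine ContinuousOn.mul (Complex.continuous_ofReal.comp_continuousOn ?_) (by fun_prop)
  refine ContinuousOn.div ?_ ?_ fun p hp => (hw.pos _ hp.1).ne'
  · exact hw.continuousOn.comp (by fun_prop) fun p hp => mul_pos (mem_Ioi.1 hp.1) (mem_Ioi.1 hp.2)
  · exact hw.continuousOn.comp (by fun_prop) fun p hp => hp.1

lemma aestronglyMeasurable (hw : IsPowerDominated w T e) (n : ℤ) {f : ℝ → ℂ}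
    (hf : ContinuousOn f (Ioi 0)) {β : ℝ} (hβ : 0 < β) :
    AEStronglyMeasurable (fun t => oscKernel w n β t * f (β * t)) (volume.restrict T) := by
  refine ((ContinuousOn.mul ?_ ?_).mono hw.subset).aestronglyMeasurable hw.measurableSet
  · exact (hw.continuousOn_oscKernel n).comp (f := fun t : ℝ => (β, t)) (by fun_prop)
      fun t ht => ⟨hβ, ht⟩
  · exact hf.comp (by fun_prop) fun t ht => mul_pos hβ ht

lemma integrableOn_oscOp (hw : IsPowerDominated w T e) (n : ℤ) {f : ℝ → ℂ} {M : ℝ}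
    (hf : ContinuousOn f (Ioi 0)) (hM : ∀ b, 0 < b → ‖f b‖ ≤ M) {β : ℝ} (hβ : 0 < β) :
    IntegrableOn (fun t => oscKernel w n β t * f (β * t)) T := by
  refine Integrable.mono' (hw.integrableOn.mul_const M) (hw.aestronglyMeasurable n hf hβ) ?_
  refine (ae_restrict_iff' hw.measurableSet).2 (Eventually.of_forall fun t ht => ?_)
  rw [norm_mul]
  have ht0 : 0 < t := hw.subset ht
  exact mul_le_mul (hw.norm_oscKernel_le n hβ ht) (hM _ (mul_pos hβ ht0)) (norm_nonneg _)
    (Real.rpow_nonneg ht0.le _)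

lemma norm_oscOp_le (hw : IsPowerDominated w T e) (n : ℤ) {f : ℝ → ℂ} {M : ℝ}
    (hM : ∀ b, 0 < b → ‖f b‖ ≤ M) {β : ℝ} (hβ : 0 < β) :
    ‖oscOp w T n f β‖ ≤ (∫ t in T, t ^ (e - 1)) * M := by
  rw [oscOp, ← MeasureTheory.integral_mul_const]
  refine MeasureTheory.norm_integral_le_of_norm_le (hw.integrableOn.mul_const M) ?_
  refine (ae_restrict_iff' hw.measurableSet).2 (Eventually.of_forall fun t ht => ?_)
  rw [norm_mul]
  have ht0 : 0 < t := hw.subset ht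
  exact mul_le_mul (hw.norm_oscKernel_le n hβ ht) (hM _ (mul_pos hβ ht0)) (norm_nonneg _)
    (Real.rpow_nonneg ht0.le _)

lemma rpow_mul_norm_oscOp_le (hw : IsPowerDominated w T e) (n : ℤ) {f : ℝ → ℂ} {H δ : ℝ}
    (hH : ∀ b, 0 < b → b ^ δ * ‖f b‖ ≤ H)
    (hint : IntegrableOn (fun t : ℝ => t ^ (e - 1 - δ)) T) {β : ℝ} (hβ : 0 < β) :
    β ^ δ * ‖oscOp w T n f β‖ ≤ (∫ t in T, t ^ (e - 1 - δ)) * H := by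
  have hpos := Real.rpow_pos_of_pos hβ δ
  rw [mul_comm, ← le_div_iff₀ hpos, mul_div_assoc, oscOp, ← MeasureTheory.integral_mul_const]
  refine MeasureTheory.norm_integral_le_of_norm_le (hint.mul_const _) ?_
  refine (ae_restrict_iff' hw.measurableSet).2 (Eventually.of_forall fun t ht => ?_)
  rw [norm_mul]
  have ht0 : 0 < t := hw.subset ht
  have h1 := hH (β * t) (mul_pos hβ ht0)
  have h2 := hw.norm_oscKernel_le n hβ ht
  have h3 := Real.rpow_pos_of_pos ht0 δ
  rw [Real.mul_rpow hβ.le ht0.le] at h1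
  have h4 : ‖f (β * t)‖ ≤ (t ^ δ)⁻¹ * (H / β ^ δ) := by
    rw [inv_mul_eq_div, le_div_iff₀ h3, le_div_iff₀ hpos]
    linarith
  calc ‖oscKernel w n β t‖ * ‖f (β * t)‖ ≤ t ^ (e - 1) * ((t ^ δ)⁻¹ * (H / β ^ δ)) :=
        mul_le_mul h2 h4 (norm_nonneg _) (Real.rpow_nonneg ht0.le _)
    _ = t ^ (e - 1 - δ) * (H / β ^ δ) := by rw [Real.rpow_sub ht0 (e - 1)]; ring

lemma tendsto_oscOp (hw : IsPowerDominated w T e) (n : ℤ) {f : ℝ → ℂ} {M : ℝ}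
    (hf : ContinuousOn f (Ioi 0)) (hM : ∀ b, 0 < b → ‖f b‖ ≤ M) {l : Filter ℝ}
    [l.IsCountablyGenerated] (hl : ∀ᶠ β in l, 0 < β) {g : ℝ → ℂ}
    (hg : ∀ t ∈ T, Tendsto (fun β => oscKernel w n β t * f (β * t)) l (𝓝 (g t))) :
    Tendsto (oscOp w T n f) l (𝓝 (∫ t in T, g t)) := by
  refine MeasureTheory.tendsto_integral_filter_of_dominated_convergence
    (fun t => t ^ (e - 1) * M) ?_ ?_ (hw.integrableOn.mul_const M) ?_
  · filter_upwards [hl] with β hβ using hw.aestronglyMeasurable n hf hβ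
  · filter_upwards [hl] with β hβ
    refine (ae_restrict_iff' hw.measurableSet).2 (Eventually.of_forall fun t ht => ?_)
    rw [norm_mul]
    have ht0 : 0 < t := hw.subset ht
    exact mul_le_mul (hw.norm_oscKernel_le n hβ ht) (hM _ (mul_pos hβ ht0)) (norm_nonneg _)
      (Real.rpow_nonneg ht0.le _)
  · exact (ae_restrict_iff' hw.measurableSet).2 (Eventually.of_forall hg)

lemma continuousOn_oscOp (hw : IsPowerDominated w T e) (n : ℤ) {f : ℝ → ℂ} {M : ℝ}
    (hf : ContinuousOn f (Ioi 0)) (hM : ∀ b, 0 < b → ‖f b‖ ≤ M) :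
    ContinuousOn (oscOp w T n f) (Ioi 0) := by
  intro β hβ
  refine hw.tendsto_oscOp n hf hM self_mem_nhdsWithin fun t ht => Tendsto.mul ?_ ?_
  · have h : ContinuousOn (fun x => oscKernel w n x t) (Ioi 0) :=
      (hw.continuousOn_oscKernel n).comp (f := fun x : ℝ => (x, t)) (by fun_prop)
        fun x hx => ⟨hx, hw.subset ht⟩
    exact h β hβ
  · have h : ContinuousOn (fun x => f (x * t)) (Ioi 0) :=
      hf.comp (by fun_prop) fun x hx => mul_pos (mem_Ioi.1 hx) (mem_Ioi.1 (hw.subset ht))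
    exact h β hβ

lemma tendsto_oscOp_atTop_of_tendsto_zero (hw : IsPowerDominated w T e) (n : ℤ) {f : ℝ → ℂ}
    {M : ℝ} (hf : ContinuousOn f (Ioi 0)) (hM : ∀ b, 0 < b → ‖f b‖ ≤ M)
    (h0 : Tendsto f atTop (𝓝 0)) : Tendsto (oscOp w T n f) atTop (𝓝 0) := by
  rw [← integral_zero ℝ ℂ (μ := volume.restrict T)]
  refine hw.tendsto_oscOp n hf hM (eventually_gt_atTop 0) fun t ht => ?_
  have ht0 : 0 < t := hw.subset ht
  refine squeeze_zero_norm' (a := fun β => t ^ (e - 1) * ‖f (β * t)‖) ?_ ?_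
  · filter_upwards [eventually_gt_atTop 0] with β hβ
    rw [norm_mul]
    exact mul_le_mul_of_nonneg_right (hw.norm_oscKernel_le n hβ ht) (norm_nonneg _)
  · have := (h0.comp (tendsto_id.atTop_mul_const ht0)).norm.const_mul (t ^ (e - 1))
    simpa using this

/-- Splitting off a constant from the argument of the operator. -/
lemma oscOp_eq_sub_add_const (hw : IsPowerDominated w T e) (n : ℤ) {f : ℝ → ℂ} {M : ℝ}
    (hf : ContinuousOn f (Ioi 0)) (hM : ∀ b, 0 < b → ‖f b‖ ≤ M) (c : ℂ) {β : ℝ} (hβ : 0 < β) :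
    oscOp w T n f β = oscOp w T n (fun b => f b - c) β + oscOp w T n (fun _ => 1) β * c := by
  have h1 := hw.integrableOn_oscOp n hf hM hβ
  have h2 := hw.integrableOn_oscOp n (f := fun _ => (1 : ℂ)) continuousOn_const
    (M := 1) (by simp) hβ
  rw [oscOp, oscOp, oscOp, ← MeasureTheory.integral_mul_const, ← MeasureTheory.integral_add]
  · congr 1
    ext t
    ring
  · exact (h1.sub (h2.mul_const c)).congr (Eventually.of_forall fun t => by simp; ring)
  · exact h2.mul_const c

/-- If `w` is the power `b ^ (p - 1)` near the origin, the operator has the limit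
`f 0 * ∫ t in T, t ^ (p - 1)` there. -/
lemma tendsto_oscOp_zero (hw : IsPowerDominated w T e) (n : ℤ) {f : ℝ → ℂ} {M p : ℝ}
    (hf : ContinuousOn f (Ici 0)) (hM : ∀ b, 0 < b → ‖f b‖ ≤ M)
    (hp : ∀ b, 0 < b → b ≤ 1 → w b = b ^ (p - 1)) :
    Tendsto (oscOp w T n f) (𝓝[>] 0) (𝓝 (((∫ t in T, t ^ (p - 1) : ℝ) : ℂ) * f 0)) := by
  rw [← integral_complex_ofReal, ← MeasureTheory.integral_mul_const]
  refine hw.tendsto_oscOp n (hf.mono Ioi_subset_Ici_self) hM self_mem_nhdsWithin fun t ht => ?_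
  have ht0 : 0 < t := hw.subset ht
  refine Tendsto.mul ?_ ?_
  · have hE : Tendsto (fun β : ℝ => Complex.exp (Complex.I * (n : ℂ) *
        ((β : ℂ) - ((β * t : ℝ) : ℂ)))) (𝓝[>] 0) (𝓝 1) := by
      have : Continuous (fun β : ℝ => Complex.exp (Complex.I * (n : ℂ) *
        ((β : ℂ) - ((β * t : ℝ) : ℂ)))) := by fun_prop
      simpa using (this.tendsto 0).mono_left nhdsWithin_le_nhds
    have := hE.const_mul ((t ^ (p - 1) : ℝ) : ℂ)
    rw [mul_one] at this
    refine this.congr' ?_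
    have hs : Ioo (0 : ℝ) (min 1 t⁻¹) ∈ 𝓝[>] (0 : ℝ) :=
      Ioo_mem_nhdsGT (lt_min one_pos (inv_pos.2 ht0))
    filter_upwards [hs] with β hβ
    have h1 : β ≤ 1 := hβ.2.le.trans (min_le_left _ _)
    have h2 : β * t ≤ 1 := by
      have := hβ.2.le.trans (min_le_right _ _)
      rwa [← one_div, le_div_iff₀ ht0] at this
    rw [oscKernel, hp _ (mul_pos hβ.1 ht0) h2, hp _ hβ.1 h1, Real.mul_rpow hβ.1.le ht0.le,
      mul_div_cancel_left₀ _ (Real.rpow_pos_of_pos hβ.1 _).ne']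
  · have h1 : Tendsto (fun β : ℝ => β * t) (𝓝[>] 0) (𝓝[≥] 0) := by
      refine tendsto_nhdsWithin_iff.2 ⟨?_, ?_⟩
      · have : Continuous fun β : ℝ => β * t := by fun_prop
        simpa using (this.tendsto 0).mono_left nhdsWithin_le_nhds
      · filter_upwards [self_mem_nhdsWithin] with β hβ
        exact mul_nonneg (le_of_lt hβ) ht0.le
    exact (hf 0 self_mem_Ici).tendsto.comp h1

end IsPowerDominated

namespace IsPowerDominated

variable {w q : ℝ → ℝ} {T : Set ℝ} {e : ℝ}

lemma hasDerivAt_oscKernel (hd : ∀ b, 0 < b → HasDerivAt w (w b * q b / b) b) {n : ℤ}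
    (hn : n ≠ 0) {β t : ℝ} (hβ : 0 < β) (ht : 0 < t) :
    HasDerivAt (fun t => oscKernel w n β t * (Complex.I / (n * β)))
      (oscKernel w n β t + oscKernel w n β t * ((q (β * t) / t : ℝ) : ℂ) *
        (Complex.I / (n * β))) t := by
  have hlin : HasDerivAt (fun t : ℝ => β * t) β t := by
    simpa using (hasDerivAt_id t).const_mul β
  have h1 := (((hd _ (mul_pos hβ ht)).comp t hlin).div_const (w β)).ofReal_comp
  have h2 : HasDerivAt (fun t : ℝ => Complex.exp (Complex.I * (n : ℂ) *
      ((β : ℂ) - ((β * t : ℝ) : ℂ)))) (Complex.exp (Complex.I * (n : ℂ) *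
      ((β : ℂ) - ((β * t : ℝ) : ℂ))) * (Complex.I * n * (-(β : ℂ)))) t := by
    simpa using ((hlin.ofReal_comp.const_sub (β : ℂ)).const_mul (Complex.I * (n : ℂ))).cexp
  refine ((h1.mul h2).mul_const (Complex.I / (n * β))).congr_deriv ?_
  have hn' : (n : ℂ) ≠ 0 := Int.cast_ne_zero.2 hn
  have hβ' : (β : ℂ) ≠ 0 := Complex.ofReal_ne_zero.2 hβ.ne'
  have ht' : (t : ℂ) ≠ 0 := Complex.ofReal_ne_zero.2 ht.ne'
  rw [oscKernel]
  simp only [Function.comp_apply]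
  push_cast
  field_simp
  linear_combination (-(w (β * t) : ℂ) * t * n * β * (w β : ℂ)⁻¹) * Complex.I_sq

lemma norm_I_div (n : ℤ) {β : ℝ} (hβ : 0 < β) :
    ‖Complex.I / ((n : ℂ) * β)‖ = |(n : ℝ)|⁻¹ * β⁻¹ := by
  rw [norm_div, Complex.norm_I, norm_mul, Complex.norm_real, Complex.norm_intCast,
    Real.norm_eq_abs, abs_of_pos hβ, one_div, mul_inv]

lemma norm_remainder_le (hw : IsPowerDominated w T e) {δ M : ℝ} (hδ : δ ≤ 1)
    (hM : ∀ b, |q b| ≤ M) (n : ℤ) {β t : ℝ} (hβ : 0 < β) (ht : t ∈ T) (hβt : 1 ≤ β * t) :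
    ‖oscKernel w n β t * ((q (β * t) / t : ℝ) : ℂ) * (Complex.I / (n * β))‖ ≤
      |(n : ℝ)|⁻¹ * M * β ^ (-δ) * t ^ (e - 1 - δ) := by
  have ht0 : 0 < t := hw.subset ht
  have hinv : (β * t)⁻¹ ≤ (β * t) ^ (-δ) := by
    rw [← Real.rpow_neg_one]
    exact Real.rpow_le_rpow_of_exponent_le hβt (by linarith)
  have hMn : 0 ≤ M := (abs_nonneg _).trans (hM 0)
  have hpt : 0 ≤ t ^ (e - 1) := Real.rpow_nonneg ht0.le _
  rw [norm_mul, norm_mul, norm_I_div n hβ, Complex.norm_real, Real.norm_eq_abs, abs_div,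
    abs_of_pos ht0]
  calc ‖oscKernel w n β t‖ * (|q (β * t)| / t) * (|(n : ℝ)|⁻¹ * β⁻¹)
      ≤ t ^ (e - 1) * (M / t) * (|(n : ℝ)|⁻¹ * β⁻¹) := by
        have := hM (β * t)
        have := hw.norm_oscKernel_le n hβ ht
        gcongr
    _ = |(n : ℝ)|⁻¹ * M * t ^ (e - 1) * (β * t)⁻¹ := by rw [mul_inv]; ring
    _ ≤ |(n : ℝ)|⁻¹ * M * t ^ (e - 1) * (β * t) ^ (-δ) := by gcongr
    _ = |(n : ℝ)|⁻¹ * M * β ^ (-δ) * t ^ (e - 1 - δ) := by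
        rw [Real.mul_rpow hβ.le ht0.le, sub_eq_add_neg (e - 1) δ, Real.rpow_add ht0]
        ring

lemma continuousOn_remainder (hw : IsPowerDominated w T e) (hq : Continuous q) (n : ℤ)
    {β : ℝ} (hβ : 0 < β) :
    ContinuousOn (fun t => oscKernel w n β t * ((q (β * t) / t : ℝ) : ℂ) *
      (Complex.I / (n * β))) (Ioi 0) := by
  refine ContinuousOn.mul (ContinuousOn.mul ?_ ?_) continuousOn_const
  · exact (hw.continuousOn_oscKernel n).comp (f := fun t : ℝ => (β, t)) (by fun_prop)
      fun t ht => ⟨hβ, ht⟩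
  · refine Complex.continuous_ofReal.comp_continuousOn (ContinuousOn.div ?_ continuousOn_id
      fun t ht => ne_of_gt ht)
    exact (by fun_prop : Continuous fun t => q (β * t)).continuousOn

/-- Oscillation gains decay: the case of the weights decreasing at infinity. -/
lemma norm_oscOp_one_le_of_Ioi (hw : IsPowerDominated w (Ioi 1) e)
    (hd : ∀ b, 0 < b → HasDerivAt w (w b * q b / b) b) (hq : Continuous q) {δ M : ℝ}
    (hδ : δ ≤ 1) (he : e < 1) (hM : ∀ b, |q b| ≤ M)
    (hint : IntegrableOn (fun t : ℝ => t ^ (e - 1 - δ)) (Ioi 1)) {n : ℤ} (hn : n ≠ 0)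
    {β : ℝ} (hβ : 1 ≤ β) :
    ‖oscOp w (Ioi 1) n (fun _ => 1) β‖ ≤
      (|(n : ℝ)|⁻¹ * (1 + M * ∫ t in Ioi (1 : ℝ), t ^ (e - 1 - δ))) * β ^ (-δ) := by
  have hβ0 : 0 < β := by linarith
  have hR : ∀ t ∈ Ioi (1 : ℝ), ‖oscKernel w n β t * ((q (β * t) / t : ℝ) : ℂ) *
      (Complex.I / (n * β))‖ ≤ |(n : ℝ)|⁻¹ * M * β ^ (-δ) * t ^ (e - 1 - δ) := fun t ht =>
    hw.norm_remainder_le hδ hM n hβ0 ht (by nlinarith [mem_Ioi.1 ht])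
  have hRae := (ae_restrict_iff' (μ := volume) measurableSet_Ioi).2 (Eventually.of_forall hR)
  have hRint : IntegrableOn (fun t => oscKernel w n β t * ((q (β * t) / t : ℝ) : ℂ) *
      (Complex.I / (n * β))) (Ioi 1) :=
    Integrable.mono' (hint.const_mul _) (((hw.continuousOn_remainder hq n hβ0).mono
      hw.subset).aestronglyMeasurable measurableSet_Ioi) hRae
  have hK : IntegrableOn (fun t => oscKernel w n β t) (Ioi 1) := by
    simpa using hw.integrableOn_oscOp n (f := fun _ => (1 : ℂ)) continuousOn_const
      (M := 1) (by simp) hβ0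
  have hlim : Tendsto (fun t => oscKernel w n β t * (Complex.I / (n * β))) atTop (𝓝 0) := by
    rw [← zero_mul (Complex.I / ((n : ℂ) * β))]
    refine Tendsto.mul_const _ (squeeze_zero_norm' (a := fun t : ℝ => t ^ (-(1 - e))) ?_ ?_)
    · filter_upwards [eventually_gt_atTop 1] with t ht
      have := hw.norm_oscKernel_le n hβ0 ht
      rwa [neg_sub]
    · exact tendsto_rpow_neg_atTop (by linarith)
  have hFTC := integral_Ioi_of_hasDerivAt_of_tendsto
    (hasDerivAt_oscKernel hd hn hβ0 one_pos).continuousAt.continuousWithinAt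
    (fun t ht => hasDerivAt_oscKernel hd hn hβ0 (hw.subset ht)) (hK.add hRint) hlim
  rw [integral_add hK hRint, zero_sub] at hFTC
  have heq : oscOp w (Ioi 1) n (fun _ => 1) β = -(oscKernel w n β 1 * (Complex.I / (n * β))) -
      ∫ t in Ioi (1 : ℝ), oscKernel w n β t * ((q (β * t) / t : ℝ) : ℂ) *
        (Complex.I / (n * β)) := by
    rw [← hFTC, add_sub_cancel_right, oscOp]
    simp
  have hG : ‖oscKernel w n β 1 * (Complex.I / (n * β))‖ ≤ |(n : ℝ)|⁻¹ * β ^ (-δ) := by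
    rw [norm_mul, hw.norm_oscKernel n hβ0 one_pos, mul_one, div_self (hw.pos _ hβ0).ne', one_mul,
      norm_I_div n hβ0, ← Real.rpow_neg_one β]
    gcongr
  have hRn := MeasureTheory.norm_integral_le_of_norm_le (hint.const_mul _) hRae
  rw [MeasureTheory.integral_const_mul] at hRn
  rw [heq]
  refine (norm_sub_le _ _).trans ?_
  rw [norm_neg]
  linarith

/-- Oscillation gains decay: the case of the weights increasing at the origin. -/
lemma norm_oscOp_one_le_of_Ioc (hw : IsPowerDominated w (Ioc 0 1) e)
    (hd : ∀ b, 0 < b → HasDerivAt w (w b * q b / b) b) (hq : Continuous q) {δ M : ℝ}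
    (hδ : δ ≤ 1) (hδe : δ ≤ e) (he : 0 < e) (hM : ∀ b, |q b| ≤ M)
    (hint : IntegrableOn (fun t : ℝ => t ^ (e - 1 - δ)) (Ioc 0 1)) {n : ℤ} (hn : n ≠ 0)
    {β : ℝ} (hβ : 1 ≤ β) :
    ‖oscOp w (Ioc 0 1) n (fun _ => 1) β‖ ≤
      (e⁻¹ + |(n : ℝ)|⁻¹ * (2 + M * ∫ t in Ioc (0 : ℝ) 1, t ^ (e - 1 - δ))) * β ^ (-δ) := by
  have hβ0 : 0 < β := by linarith
  have hs0 : 0 < β⁻¹ := inv_pos.2 hβ0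
  have hs1 : β⁻¹ ≤ 1 := inv_le_one_of_one_le₀ hβ
  have hsub : Ioc β⁻¹ 1 ⊆ Ioc (0 : ℝ) 1 := Ioc_subset_Ioc_left hs0.le
  have hMn : 0 ≤ M := (abs_nonneg _).trans (hM 0)
  have hse : β⁻¹ ^ e ≤ β ^ (-δ) := by
    rw [Real.inv_rpow hβ0.le, ← Real.rpow_neg hβ0.le]
    exact Real.rpow_le_rpow_of_exponent_le hβ (by linarith)
  have hR : ∀ t ∈ Ioc β⁻¹ 1, ‖oscKernel w n β t * ((q (β * t) / t : ℝ) : ℂ) *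
      (Complex.I / (n * β))‖ ≤ |(n : ℝ)|⁻¹ * M * β ^ (-δ) * t ^ (e - 1 - δ) := fun t ht =>
    hw.norm_remainder_le hδ hM n hβ0 (hsub ht) (by
      rw [mul_comm, ← div_le_iff₀ hβ0, one_div]
      exact ht.1.le)
  have hRae := (ae_restrict_iff' (μ := volume) measurableSet_Ioc).2 (Eventually.of_forall hR)
  have hRint : IntegrableOn (fun t => oscKernel w n β t * ((q (β * t) / t : ℝ) : ℂ) *
      (Complex.I / (n * β))) (Ioc β⁻¹ 1) :=
    Integrable.mono' ((hint.mono_set hsub).const_mul _) (((hw.continuousOn_remainder hq n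
      hβ0).mono (hsub.trans hw.subset)).aestronglyMeasurable measurableSet_Ioc) hRae
  have hK : IntegrableOn (fun t => oscKernel w n β t) (Ioc 0 1) := by
    simpa using hw.integrableOn_oscOp n (f := fun _ => (1 : ℂ)) continuousOn_const
      (M := 1) (by simp) hβ0
  have hK1 := hK.mono_set hsub
  have hK0 : IntegrableOn (fun t => oscKernel w n β t) (Ioc 0 β⁻¹) :=
    hK.mono_set (Ioc_subset_Ioc_right hs1)
  have hFTC := intervalIntegral.integral_eq_sub_of_hasDerivAt (a := β⁻¹) (b := 1)
    (fun t ht => hasDerivAt_oscKernel hd hn hβ0 (by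
      rw [uIcc_of_le hs1] at ht
      exact hs0.trans_le ht.1)) ((intervalIntegrable_iff_integrableOn_Ioc_of_le hs1).2
      (hK1.add hRint))
  rw [intervalIntegral.integral_of_le hs1, MeasureTheory.integral_add hK1 hRint] at hFTC
  have hsplit : oscOp w (Ioc 0 1) n (fun _ => 1) β =
      (∫ t in Ioc 0 β⁻¹, oscKernel w n β t) + ∫ t in Ioc β⁻¹ 1, oscKernel w n β t := by
    rw [oscOp, ← Ioc_union_Ioc_eq_Ioc hs0.le hs1,
      ← setIntegral_union (Ioc_disjoint_Ioc_of_le le_rfl) measurableSet_Ioc hK0 hK1]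
    simp
  have hhead : ‖∫ t in Ioc 0 β⁻¹, oscKernel w n β t‖ ≤ e⁻¹ * β ^ (-δ) := by
    have hle : ‖∫ t in Ioc 0 β⁻¹, oscKernel w n β t‖ ≤ ∫ t in Ioc 0 β⁻¹, t ^ (e - 1) :=
      MeasureTheory.norm_integral_le_of_norm_le
        (hw.integrableOn.mono_set (Ioc_subset_Ioc_right hs1))
        ((ae_restrict_iff' measurableSet_Ioc).2 (Eventually.of_forall fun t ht =>
          hw.norm_oscKernel_le n hβ0 (Ioc_subset_Ioc_right hs1 ht)))
    have heq : ∫ t in Ioc 0 β⁻¹, t ^ (e - 1) = e⁻¹ * β⁻¹ ^ e := by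
      rw [← intervalIntegral.integral_of_le hs0.le, integral_rpow (Or.inl (by linarith)),
        sub_add_cancel, Real.zero_rpow he.ne', sub_zero, div_eq_inv_mul]
    exact (hle.trans_eq heq).trans (mul_le_mul_of_nonneg_left hse (inv_pos.2 he).le)
  have hG1 : ‖oscKernel w n β 1 * (Complex.I / (n * β))‖ ≤ |(n : ℝ)|⁻¹ * β ^ (-δ) := by
    rw [norm_mul, hw.norm_oscKernel n hβ0 one_pos, mul_one, div_self (hw.pos _ hβ0).ne', one_mul,
      norm_I_div n hβ0, ← Real.rpow_neg_one β]
    gcongr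
  have hGs : ‖oscKernel w n β β⁻¹ * (Complex.I / (n * β))‖ ≤ |(n : ℝ)|⁻¹ * β ^ (-δ) := by
    rw [norm_mul, norm_I_div n hβ0]
    calc ‖oscKernel w n β β⁻¹‖ * (|(n : ℝ)|⁻¹ * β⁻¹)
        ≤ β⁻¹ ^ (e - 1) * (|(n : ℝ)|⁻¹ * β⁻¹) := by
          have := hw.norm_oscKernel_le n hβ0 (t := β⁻¹) ⟨hs0, hs1⟩
          gcongr
      _ = |(n : ℝ)|⁻¹ * β⁻¹ ^ e := by
          rw [Real.rpow_sub_one hs0.ne']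
          field_simp
      _ ≤ |(n : ℝ)|⁻¹ * β ^ (-δ) := by gcongr
  have hRn := MeasureTheory.norm_integral_le_of_norm_le ((hint.mono_set hsub).const_mul _) hRae
  rw [MeasureTheory.integral_const_mul] at hRn
  have hmono : ∫ t in Ioc β⁻¹ 1, t ^ (e - 1 - δ) ≤ ∫ t in Ioc (0 : ℝ) 1, t ^ (e - 1 - δ) :=
    setIntegral_mono_set hint ((ae_restrict_iff' measurableSet_Ioc).2
      (Eventually.of_forall fun t ht => Real.rpow_nonneg ht.1.le _)) hsub.eventuallyLE
  have hcoef : 0 ≤ |(n : ℝ)|⁻¹ * M * β ^ (-δ) := by positivity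
  have hRn' := hRn.trans (mul_le_mul_of_nonneg_left hmono hcoef)
  rw [hsplit, eq_sub_of_add_eq hFTC]
  refine (norm_add_le _ _).trans ?_
  have h1 := norm_sub_le (oscKernel w n β 1 * (Complex.I / (n * β)) -
    oscKernel w n β β⁻¹ * (Complex.I / (n * β))) (∫ t in Ioc β⁻¹ 1, oscKernel w n β t *
      ((q (β * t) / t : ℝ) : ℂ) * (Complex.I / (n * β)))
  have h2 := norm_sub_le (oscKernel w n β 1 * (Complex.I / (n * β)))
    (oscKernel w n β β⁻¹ * (Complex.I / (n * β)))
  linarith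

end IsPowerDominated

lemma rpow_div_WFun (μ : ℝ) (η : ℝ → ℝ) (n : ℤ) {β : ℝ} (hβ : 0 < β) :
    β ^ (2 * μ - 1) / WFun μ η n β = (weightFun μ η n β)⁻¹ * β⁻¹ := by
  rw [weightFun, Real.rpow_sub_one hβ.ne', Real.rpow_neg hβ.le, mul_inv, inv_inv]
  ring

lemma oscKernel_mul_eq (w : ℝ → ℝ) (n : ℤ) (f : ℝ → ℂ) (β t : ℝ) :
    oscKernel w n β t * f (β * t) = (((w β)⁻¹ : ℝ) : ℂ) * (((w (β * t) : ℝ) : ℂ) *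
      Complex.exp (Complex.I * (n : ℂ) * ((β : ℂ) - ((β * t : ℝ) : ℂ))) * f (β * t)) := by
  rw [oscKernel, div_eq_inv_mul]
  push_cast
  ring

lemma Lminus_eq_neg_oscOp {μ : ℝ} {η : ℝ → ℝ} {n : ℤ} (hn : 2 ≤ |n|) (f : ℝ → ℂ) {β : ℝ}
    (hβ : 0 < β) : Lminus μ η n f β = -oscOp (weightFun μ η n) (Ioc 0 1) n f β := by
  rw [Lminus, if_pos hn, oscOp, rpow_div_WFun μ η n hβ,
    ← intervalIntegral.integral_of_le zero_le_one]
  simp_rw [oscKernel_mul_eq]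
  rw [intervalIntegral.integral_const_mul, intervalIntegral.integral_comp_mul_left
    (fun b => ((weightFun μ η n b : ℝ) : ℂ) *
      Complex.exp (Complex.I * (n : ℂ) * ((β : ℂ) - (b : ℂ))) * f b) hβ.ne', mul_zero, mul_one,
    Complex.real_smul, Complex.ofReal_mul, mul_assoc]
  rfl

lemma Lminus_eq_oscOp {μ : ℝ} {η : ℝ → ℝ} {n : ℤ} (hn : ¬ 2 ≤ |n|) (f : ℝ → ℂ) {β : ℝ}
    (hβ : 0 < β) : Lminus μ η n f β = oscOp (weightFun μ η n) (Ioi 1) n f β := by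
  rw [Lminus, if_neg hn, oscOp, rpow_div_WFun μ η n hβ]
  simp_rw [oscKernel_mul_eq]
  rw [MeasureTheory.integral_const_mul, integral_comp_mul_left_Ioi
    (fun b => ((weightFun μ η n b : ℝ) : ℂ) *
      Complex.exp (Complex.I * (n : ℂ) * ((β : ℂ) - (b : ℂ))) * f b) 1 hβ, mul_one,
    Complex.real_smul, Complex.ofReal_mul, mul_assoc]
  rfl

lemma setIntegral_Ioc_rpow_sub_one {r : ℝ} (hr : 0 < r) :
    ∫ t in Ioc (0 : ℝ) 1, t ^ (r - 1) = r⁻¹ := by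
  rw [← intervalIntegral.integral_of_le zero_le_one, integral_rpow (Or.inl (by linarith)),
    sub_add_cancel, Real.zero_rpow hr.ne', Real.one_rpow, sub_zero, one_div]

lemma integrableOn_Ioc_rpow_sub_one {r : ℝ} (hr : 0 < r) :
    IntegrableOn (fun t : ℝ => t ^ (r - 1)) (Ioc 0 1) :=
  (intervalIntegrable_iff_integrableOn_Ioc_of_le zero_le_one).1
    (intervalIntegral.intervalIntegrable_rpow' (by linarith))

lemma setIntegral_Ioi_rpow_sub_one {r : ℝ} (hr : r < 0) :
    ∫ t in Ioi (1 : ℝ), t ^ (r - 1) = -r⁻¹ := by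
  rw [integral_Ioi_rpow_of_lt (by linarith) one_pos, sub_add_cancel, Real.one_rpow, neg_div,
    one_div]

lemma exists_norm_le_of_continuousOn_of_tendsto {f : ℝ → ℂ} {L : ℂ}
    (hf : ContinuousOn f (Ici 0)) (hL : Tendsto f atTop (𝓝 L)) :
    ∃ M, ∀ b, 0 ≤ b → ‖f b‖ ≤ M := by
  obtain ⟨R, hR⟩ := eventually_atTop.1
    (hL.norm.eventually (gt_mem_nhds (lt_add_one ‖L‖)))
  obtain ⟨M, hM⟩ := isCompact_Icc.exists_bound_of_continuousOn
    (hf.mono (Icc_subset_Ici_self : Icc 0 R ⊆ Ici 0))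
  refine ⟨max M (‖L‖ + 1), fun b hb => ?_⟩
  rcases le_total b R with h | h
  · exact (hM b ⟨hb, h⟩).trans (le_max_left _ _)
  · exact (hR b h).le.trans (le_max_right _ _)

namespace IsPowerDominated

variable {w : ℝ → ℝ} {T : Set ℝ} {e : ℝ}

lemma tendsto_oscOp_atTop (hw : IsPowerDominated w T e) {n : ℤ} {δ D : ℝ} (hδ : 0 < δ)
    (hD : ∀ β, 1 ≤ β → ‖oscOp w T n (fun _ => 1) β‖ ≤ D * β ^ (-δ)) {f : ℝ → ℂ} {L : ℂ}
    (hf : ContinuousOn f (Ici 0)) (hL : Tendsto f atTop (𝓝 L)) :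
    Tendsto (oscOp w T n f) atTop (𝓝 0) := by
  obtain ⟨M, hM⟩ := exists_norm_le_of_continuousOn_of_tendsto hf hL
  have hf' := hf.mono Ioi_subset_Ici_self
  have h1 : Tendsto (oscOp w T n fun b => f b - L) atTop (𝓝 0) :=
    hw.tendsto_oscOp_atTop_of_tendsto_zero n (M := M + ‖L‖) (hf'.sub continuousOn_const)
      (fun b hb => (norm_sub_le _ _).trans (by linarith [hM b hb.le]))
      (by simpa using hL.sub_const L)
  have h2 : Tendsto (oscOp w T n fun _ => 1) atTop (𝓝 0) := by
    refine squeeze_zero_norm' (eventually_atTop.2 ⟨1, hD⟩) ?_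
    simpa using (tendsto_rpow_neg_atTop hδ).const_mul D
  have h3 := h1.add (h2.mul_const L)
  rw [zero_mul, add_zero] at h3
  refine h3.congr' ?_
  filter_upwards [eventually_gt_atTop 0] with β hβ
  exact (hw.oscOp_eq_sub_add_const n hf' (fun b hb => hM b hb.le) L hβ).symm

/-- The weighted bound for any function of the same modulus as `oscOp w T n f`. -/
lemma supNIoi_add_hoel_le (hw : IsPowerDominated w T e) {n : ℤ} {δ D : ℝ} (hδ : 0 < δ)
    (hint : IntegrableOn (fun t : ℝ => t ^ (e - 1 - δ)) T)
    (hD : ∀ β, 1 ≤ β → ‖oscOp w T n (fun _ => 1) β‖ ≤ D * β ^ (-δ)) {f g : ℝ → ℂ} {L : ℂ}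
    (hf : ContinuousOn f (Ici 0)) (hL : Tendsto f atTop (𝓝 L))
    (hbdd : BddAbove (Set.range fun β : Ioi (0 : ℝ) => (β : ℝ) ^ δ * ‖f (β : ℝ) - L‖))
    (hg : ∀ β, 0 < β → ‖g β‖ = ‖oscOp w T n f β‖) :
    BddAbove (Set.range fun β : Ioi (0 : ℝ) => (β : ℝ) ^ δ * ‖g (β : ℝ)‖) ∧
      supNIoi g + hoel δ g 0 ≤ (2 * (∫ t in T, t ^ (e - 1)) + (∫ t in T, t ^ (e - 1 - δ)) + D) *
        (supN f + hoel δ f L) := by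
  obtain ⟨M, hM⟩ := exists_norm_le_of_continuousOn_of_tendsto hf hL
  have hsup : ∀ b, 0 ≤ b → ‖f b‖ ≤ supN f := fun b hb =>
    le_ciSup (f := fun β : Ici (0 : ℝ) => ‖f (β : ℝ)‖)
      ⟨M, by rintro _ ⟨x, rfl⟩; exact hM x x.2⟩ ⟨b, hb⟩
  have hhoel : ∀ b, 0 < b → b ^ δ * ‖f b - L‖ ≤ hoel δ f L := fun b hb =>
    le_ciSup (f := fun β : Ioi (0 : ℝ) => (β : ℝ) ^ δ * ‖f (β : ℝ) - L‖) hbdd ⟨b, hb⟩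
  have hL' : ‖L‖ ≤ supN f := le_of_tendsto hL.norm
    (eventually_atTop.2 ⟨0, fun b hb => hsup b hb⟩)
  have hF : 0 ≤ supN f := (norm_nonneg _).trans hL'
  have hH : 0 ≤ hoel δ f L := le_trans (by positivity) (hhoel 1 one_pos)
  have hD0 : 0 ≤ D := by
    simpa using (norm_nonneg _).trans (hD 1 le_rfl)
  set B := ∫ t in T, t ^ (e - 1)
  set B' := ∫ t in T, t ^ (e - 1 - δ)
  have hB : 0 ≤ B := setIntegral_nonneg hw.measurableSet fun t ht =>
    Real.rpow_nonneg (le_of_lt (hw.subset ht)) _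
  have hB' : 0 ≤ B' := setIntegral_nonneg hw.measurableSet fun t ht =>
    Real.rpow_nonneg (le_of_lt (hw.subset ht)) _
  have h1 : ∀ β, 0 < β → ‖g β‖ ≤ B * supN f := fun β hβ =>
    (hg β hβ).trans_le (hw.norm_oscOp_le n (fun b hb => hsup b hb.le) hβ)
  have h2 : ∀ β, 0 < β → β ^ δ * ‖g β‖ ≤ (B + B' + D) * (supN f + hoel δ f L) := by
    intro β hβ
    rcases le_total β 1 with hβ1 | hβ1
    · calc β ^ δ * ‖g β‖ ≤ 1 * (B * supN f) :=
            mul_le_mul (Real.rpow_le_one hβ.le hβ1 hδ.le) (h1 β hβ) (norm_nonneg _) zero_le_one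
        _ = B * supN f := one_mul _
        _ ≤ (B + B' + D) * (supN f + hoel δ f L) := by gcongr <;> linarith
    · have h3 := hw.rpow_mul_norm_oscOp_le n hhoel hint hβ
      have h4 : β ^ δ * ‖oscOp w T n (fun _ => 1) β‖ ≤ D := by
        have hpos := Real.rpow_pos_of_pos hβ δ
        rw [mul_comm, ← le_div_iff₀ hpos, div_eq_mul_inv, ← Real.rpow_neg hβ.le]
        exact hD β hβ1
      calc β ^ δ * ‖g β‖
          ≤ β ^ δ * (‖oscOp w T n (fun b => f b - L) β‖ +
              ‖oscOp w T n (fun _ => 1) β‖ * ‖L‖) := by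
            rw [hg β hβ, hw.oscOp_eq_sub_add_const n (hf.mono Ioi_subset_Ici_self)
              (fun b hb => hM b hb.le) L hβ, ← norm_mul]
            gcongr
            exact norm_add_le _ _
        _ = β ^ δ * ‖oscOp w T n (fun b => f b - L) β‖ +
              β ^ δ * ‖oscOp w T n (fun _ => 1) β‖ * ‖L‖ := by ring
        _ ≤ B' * hoel δ f L + D * supN f := by gcongr
        _ ≤ (B + B' + D) * (supN f + hoel δ f L) := by
            nlinarith [mul_nonneg hB hF, mul_nonneg hB hH, mul_nonneg hB' hF, mul_nonneg hD0 hH]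
  have : Nonempty (Ioi (0 : ℝ)) := ⟨⟨1, mem_Ioi.2 one_pos⟩⟩
  refine ⟨⟨_, by rintro _ ⟨x, rfl⟩; exact h2 x x.2⟩, ?_⟩
  have h5 : supNIoi g ≤ B * supN f := ciSup_le fun x => h1 x x.2
  have h6 : hoel δ g 0 ≤ (B + B' + D) * (supN f + hoel δ f L) := ciSup_le fun x => by
    simpa only [sub_zero] using h2 x x.2
  nlinarith [mul_nonneg hB hH]

end IsPowerDominated

lemma continuousOn_weightFun {μ : ℝ} {η : ℝ → ℝ} (hη : Continuous η) (n : ℤ) :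
    ContinuousOn (weightFun μ η n) (Ioi 0) := fun _ hb =>
  (hasDerivAt_weightFun hη n hb).continuousAt.continuousWithinAt

lemma isPowerDominated_weightFun_Ioc {μ e : ℝ} {η : ℝ → ℝ} (hη : Continuous η) {n : ℤ}
    (he : 0 < e) (hle : ∀ b, e ≤ aFun μ η n b + 1 - 2 * μ) :
    IsPowerDominated (weightFun μ η n) (Ioc 0 1) e where
  measurableSet := measurableSet_Ioc
  subset := Ioc_subset_Ioi_self
  continuousOn := continuousOn_weightFun hη n
  pos _ hb := weightFun_pos μ η n hb
  div_le _ hβ _ ht := weightFun_div_le_of_le_one hη hle hβ ht.1 ht.2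
  integrableOn := integrableOn_Ioc_rpow_sub_one he

lemma isPowerDominated_weightFun_Ioi {μ e : ℝ} {η : ℝ → ℝ} (hη : Continuous η) {n : ℤ}
    (he : e < 0) (hle : ∀ b, aFun μ η n b + 1 - 2 * μ ≤ e) :
    IsPowerDominated (weightFun μ η n) (Ioi 1) e where
  measurableSet := measurableSet_Ioi
  subset := Ioi_subset_Ioi zero_le_one
  continuousOn := continuousOn_weightFun hη n
  pos _ hb := weightFun_pos μ η n hb
  div_le _ hβ _ ht := weightFun_div_le_of_one_le hη hle hβ (le_of_lt ht)
  integrableOn := integrableOn_Ioi_rpow_of_lt (by linarith) one_pos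

lemma abs_aFun_sub_le {μ : ℝ} {η : ℝ → ℝ} (hμ : 1 < μ) (hη : ∀ b, 0 ≤ η b) {n : ℤ} (b : ℝ) :
    |aFun μ η n b - 2 * μ| ≤ |(n : ℝ)| * μ + 2 * μ := by
  have h1 := aFun_le hμ (hη b) n
  have h2 : 0 ≤ aFun μ η n b := Real.sqrt_nonneg _
  rw [abs_le]
  constructor <;> nlinarith [abs_nonneg (n : ℝ)]

/-- The growth exponent of `b W_n(b) b^{-2μ}` exceeds `δ` by an amount linear in `|n| ≥ 2`. -/
lemma mul_abs_le_sqrt_sub {μ δ : ℝ} (hμ : 1 < μ) (hδ : 0 < δ) {n : ℤ} (hn : 2 ≤ |(n : ℝ)|) :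
    (Real.sqrt (4 * μ ^ 2 - 2 * μ + 1) - 2 * μ + 1 - δ) / 2 * |(n : ℝ)| ≤
      Real.sqrt ((n : ℝ) ^ 2 * μ ^ 2 - (2 * μ - 1)) + 1 - 2 * μ - δ := by
  have h : |(n : ℝ)| / 2 * Real.sqrt (4 * μ ^ 2 - 2 * μ + 1) ≤
      Real.sqrt ((n : ℝ) ^ 2 * μ ^ 2 - (2 * μ - 1)) := by
    apply Real.le_sqrt_of_sq_le
    rw [mul_pow, Real.sq_sqrt (by nlinarith), div_pow, sq_abs]
    have : (4 : ℝ) ≤ (n : ℝ) ^ 2 := by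
      rw [← sq_abs]
      nlinarith
    nlinarith
  nlinarith

lemma exists_weightFun_Ioc_bound {μ δ : ℝ} (hμ : 1 < μ) (hδ0 : 0 < δ) (hδ1 : δ ≤ 1)
    (hδ : δ < Real.sqrt (4 * μ ^ 2 - 2 * μ + 1) - 2 * μ + 1) {η : ℝ → ℝ} (hη : Continuous η)
    (hη_range : ∀ β, 0 ≤ η β ∧ η β ≤ 1) {n : ℤ} (hn : 2 ≤ |n|) :
    ∃ e D : ℝ, IsPowerDominated (weightFun μ η n) (Ioc 0 1) e ∧
      IntegrableOn (fun t : ℝ => t ^ (e - 1 - δ)) (Ioc 0 1) ∧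
      (∀ β, 1 ≤ β → ‖oscOp (weightFun μ η n) (Ioc 0 1) n (fun _ => 1) β‖ ≤ D * β ^ (-δ)) ∧
      2 * (∫ t in Ioc (0 : ℝ) 1, t ^ (e - 1)) + (∫ t in Ioc (0 : ℝ) 1, t ^ (e - 1 - δ)) + D ≤
        ((4 + 3 * μ) * ((Real.sqrt (4 * μ ^ 2 - 2 * μ + 1) - 2 * μ + 1 - δ) / 2)⁻¹ + 2) *
          |(n : ℝ)|⁻¹ := by
  have hn2 : 2 ≤ |(n : ℝ)| := by exact_mod_cast hn
  have hN : 0 < |(n : ℝ)| := by linarith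
  have hn0 : n ≠ 0 := by
    rintro rfl
    norm_num at hn
  have hgap := mul_abs_le_sqrt_sub hμ hδ0 hn2
  set κ := (Real.sqrt (4 * μ ^ 2 - 2 * μ + 1) - 2 * μ + 1 - δ) / 2 with hκ
  have hκ0 : 0 < κ := by rw [hκ]; linarith
  set e := Real.sqrt ((n : ℝ) ^ 2 * μ ^ 2 - (2 * μ - 1)) + 1 - 2 * μ with he
  have hκN : 0 < κ * |(n : ℝ)| := mul_pos hκ0 hN
  have heδ : 0 < e - δ := by linarith
  have he0 : 0 < e := by linarith
  have hw : IsPowerDominated (weightFun μ η n) (Ioc 0 1) e :=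
    isPowerDominated_weightFun_Ioc hη he0 fun b => by linarith [le_aFun hμ (hη_range b).2 n]
  have hint : IntegrableOn (fun t : ℝ => t ^ (e - 1 - δ)) (Ioc 0 1) := by
    rw [sub_right_comm]
    exact integrableOn_Ioc_rpow_sub_one heδ
  have hD := fun β hβ => hw.norm_oscOp_one_le_of_Ioc
    (fun b hb => hasDerivAt_weightFun (μ := μ) hη n hb)
    ((continuous_aFun hη n).sub continuous_const) hδ1 (by linarith) he0
    (abs_aFun_sub_le hμ fun b => (hη_range b).1) hint hn0 (β := β) hβ
  refine ⟨e, _, hw, hint, hD, ?_⟩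
  rw [setIntegral_Ioc_rpow_sub_one he0, sub_right_comm, setIntegral_Ioc_rpow_sub_one heδ]
  have h1 : (e - δ)⁻¹ ≤ κ⁻¹ * |(n : ℝ)|⁻¹ := by
    rw [← mul_inv]
    exact inv_anti₀ hκN hgap
  have h2 : e⁻¹ ≤ κ⁻¹ * |(n : ℝ)|⁻¹ := (inv_anti₀ heδ (by linarith)).trans h1
  have h3 : |(n : ℝ)|⁻¹ * ((|(n : ℝ)| * μ + 2 * μ) * (e - δ)⁻¹) ≤
      3 * μ * (κ⁻¹ * |(n : ℝ)|⁻¹) := by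
    have h4 : |(n : ℝ)|⁻¹ * (|(n : ℝ)| * μ + 2 * μ) ≤ 3 * μ := by
      rw [inv_mul_le_iff₀ hN]
      nlinarith
    rw [← mul_assoc]
    exact mul_le_mul h4 h1 (inv_pos.2 heδ).le (by linarith)
  linarith

lemma exists_weightFun_Ioi_bound {μ δ : ℝ} (hμ : 1 < μ) (hδ0 : 0 < δ) (hδ1 : δ ≤ 1)
    {η : ℝ → ℝ} (hη : Continuous η) (hη_range : ∀ β, 0 ≤ η β ∧ η β ≤ 1) {n : ℤ}
    (hn : |(n : ℝ)| = 1) :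
    ∃ e D : ℝ, IsPowerDominated (weightFun μ η n) (Ioi 1) e ∧
      IntegrableOn (fun t : ℝ => t ^ (e - 1 - δ)) (Ioi 1) ∧
      (∀ β, 1 ≤ β → ‖oscOp (weightFun μ η n) (Ioi 1) n (fun _ => 1) β‖ ≤ D * β ^ (-δ)) ∧
      2 * (∫ t in Ioi (1 : ℝ), t ^ (e - 1)) + (∫ t in Ioi (1 : ℝ), t ^ (e - 1 - δ)) + D ≤
        ((3 + 3 * μ) * (μ - 1)⁻¹ + 1) * |(n : ℝ)|⁻¹ := by
  have hn0 : n ≠ 0 := by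
    rintro rfl
    norm_num at hn
  have he0 : 1 - μ < 0 := by linarith
  have heδ : 1 - μ - δ < 0 := by linarith
  have hw : IsPowerDominated (weightFun μ η n) (Ioi 1) (1 - μ) :=
    isPowerDominated_weightFun_Ioi hη he0 fun b => by
      have := aFun_le hμ (hη_range b).1 n
      rw [hn] at this
      linarith
  have hint : IntegrableOn (fun t : ℝ => t ^ (1 - μ - 1 - δ)) (Ioi 1) :=
    integrableOn_Ioi_rpow_of_lt (by linarith) one_pos
  have hD := fun β hβ => hw.norm_oscOp_one_le_of_Ioi
    (fun b hb => hasDerivAt_weightFun (μ := μ) hη n hb)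
    ((continuous_aFun hη n).sub continuous_const) hδ1 (by linarith)
    (abs_aFun_sub_le hμ fun b => (hη_range b).1) hint hn0 (β := β) hβ
  refine ⟨1 - μ, _, hw, hint, hD, ?_⟩
  rw [setIntegral_Ioi_rpow_sub_one he0, sub_right_comm, setIntegral_Ioi_rpow_sub_one heδ, hn]
  rw [← inv_neg, ← inv_neg, neg_sub, show -(1 - μ - δ) = μ - 1 + δ by ring]
  have h1 : (μ - 1 + δ)⁻¹ ≤ (μ - 1)⁻¹ := inv_anti₀ (by linarith) (by linarith)
  have h2 : μ * (μ - 1 + δ)⁻¹ ≤ μ * (μ - 1)⁻¹ := by gcongr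
  norm_num
  linarith

/-- Boundedness of `L_{n,-}^{-1} : 𝒞 → 𝒞` and
`L_{n,-}^{-1} : 𝒞^δ → 𝒞^δ_0` with operator norm `≲ |n|⁻¹`, uniformly in `n ≠ 0`. -/
theorem stmt_8 (μ δ : ℝ) (hμ : 1 < μ)
    (hδ0 : 0 < δ)
    (hδ1 : δ < min (Real.sqrt (4 * μ ^ 2 - 2 * μ + 1) - 2 * μ + 1) 1)
    (η : ℝ → ℝ) (hη_smooth : ContDiff ℝ (⊤ : ℕ∞) η)
    (hη_range : ∀ β, 0 ≤ η β ∧ η β ≤ 1)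
    (hη0 : ∀ β : ℝ, β ≤ 1 → η β = 0) (hη1 : ∀ β : ℝ, 2 ≤ β → η β = 1) :
    (∀ n : ℤ, n ≠ 0 → ∀ (f : ℝ → ℂ) (L : ℂ),
      ContinuousOn f (Ici 0) → Tendsto f atTop (nhds L) →
      ContinuousOn (Lminus μ η n f) (Ioi 0) ∧
      Tendsto (Lminus μ η n f) (nhdsWithin 0 (Ioi 0))
        (nhds (f 0 / ((2 * μ - 1 - |(n : ℝ)| * μ : ℝ) : ℂ))) ∧
      Tendsto (Lminus μ η n f) atTop (nhds 0)) ∧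
    (∃ C : ℝ, 0 < C ∧ ∀ n : ℤ, n ≠ 0 → ∀ (f : ℝ → ℂ) (L : ℂ),
      ContinuousOn f (Ici 0) → Tendsto f atTop (nhds L) →
      BddAbove (Set.range fun β : Ioi (0 : ℝ) => (β : ℝ) ^ δ * ‖f (β : ℝ) - L‖) →
      BddAbove (Set.range fun β : Ioi (0 : ℝ) => (β : ℝ) ^ δ * ‖Lminus μ η n f (β : ℝ)‖) ∧
      supNIoi (Lminus μ η n f) + hoel δ (Lminus μ η n f) 0 ≤
        C * |(n : ℝ)|⁻¹ * (supN f + hoel δ f L)) := by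
  have hη := hη_smooth.continuous
  have hδS := hδ1.trans_le (min_le_left _ _)
  have hδone := (hδ1.trans_le (min_le_right _ _)).le
  have habs : ∀ n : ℤ, n ≠ 0 → ¬ 2 ≤ |n| → |(n : ℝ)| = 1 := fun n hn h => by
    have h1 := Int.one_le_abs hn
    have h2 : |n| = 1 := by omega
    exact_mod_cast h2
  have hpow : ∀ n : ℤ, ∀ b, 0 < b → b ≤ 1 →
      weightFun μ η n b = b ^ (|(n : ℝ)| * μ - 2 * μ + 1 - 1) := fun n b hb hb1 => by
    rw [weightFun_of_le_one hμ hη0 n hb hb1, add_sub_cancel_right]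
  refine ⟨fun n hn f L hf hL => ?_, ?_⟩
  · obtain ⟨M, hM⟩ := exists_norm_le_of_continuousOn_of_tendsto hf hL
    have hM' : ∀ b, 0 < b → ‖f b‖ ≤ M := fun b hb => hM b hb.le
    have hf' := hf.mono Ioi_subset_Ici_self
    by_cases h2 : 2 ≤ |n|
    · obtain ⟨e, D, hw, -, hD, -⟩ :=
        exists_weightFun_Ioc_bound hμ hδ0 hδone hδS hη hη_range h2
      have heq : EqOn (Lminus μ η n f) (fun β => -oscOp (weightFun μ η n) (Ioc 0 1) n f β)
        (Ioi 0) := fun β hβ => Lminus_eq_neg_oscOp h2 f hβ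
      refine ⟨(hw.continuousOn_oscOp n hf' hM').neg.congr heq, ?_, ?_⟩
      · have hlim := (hw.tendsto_oscOp_zero n hf hM' (hpow n)).neg.congr'
          (eventuallyEq_nhdsWithin_of_eqOn heq.symm)
        convert hlim using 2
        have hn2 : 2 ≤ |(n : ℝ)| := by exact_mod_cast h2
        rw [setIntegral_Ioc_rpow_sub_one (by nlinarith), ← neg_mul, ← Complex.ofReal_neg,
          ← inv_neg, div_eq_inv_mul, ← Complex.ofReal_inv]
        congr 5
        ring
      · rw [← neg_zero]
        refine (hw.tendsto_oscOp_atTop hδ0 hD hf hL).neg.congr' ?_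
        filter_upwards [eventually_gt_atTop 0] with β hβ using (heq hβ).symm
    · obtain ⟨e, D, hw, -, hD, -⟩ :=
        exists_weightFun_Ioi_bound hμ hδ0 hδone hη hη_range (habs n hn h2)
      have heq : EqOn (Lminus μ η n f) (oscOp (weightFun μ η n) (Ioi 1) n f) (Ioi 0) :=
        fun β hβ => Lminus_eq_oscOp h2 f hβ
      refine ⟨(hw.continuousOn_oscOp n hf' hM').congr heq, ?_, ?_⟩
      · have hlim := (hw.tendsto_oscOp_zero n hf hM' (hpow n)).congr'
          (eventuallyEq_nhdsWithin_of_eqOn heq.symm)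
        convert hlim using 2
        rw [habs n hn h2, setIntegral_Ioi_rpow_sub_one (by linarith), ← inv_neg, div_eq_inv_mul,
          ← Complex.ofReal_inv]
        congr 4
        ring
      · refine (hw.tendsto_oscOp_atTop hδ0 hD hf hL).congr' ?_
        filter_upwards [eventually_gt_atTop 0] with β hβ using (heq hβ).symm
  · set C₁ := (4 + 3 * μ) * ((Real.sqrt (4 * μ ^ 2 - 2 * μ + 1) - 2 * μ + 1 - δ) / 2)⁻¹ + 2
    set C₂ := (3 + 3 * μ) * (μ - 1)⁻¹ + 1
    have hC₁ : 0 < C₁ := by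
      have : 0 < ((Real.sqrt (4 * μ ^ 2 - 2 * μ + 1) - 2 * μ + 1 - δ) / 2)⁻¹ :=
        inv_pos.2 (by linarith)
      positivity
    have hC₂ : 0 < C₂ := by
      have : 0 < (μ - 1)⁻¹ := inv_pos.2 (by linarith)
      positivity
    refine ⟨max C₁ C₂, lt_max_of_lt_left hC₁, fun n hn f L hf hL hbdd => ?_⟩
    have hnn : 0 ≤ supN f + hoel δ f L := add_nonneg (Real.iSup_nonneg fun _ => norm_nonneg _)
      (Real.iSup_nonneg fun x => mul_nonneg (Real.rpow_nonneg (le_of_lt x.2) _) (norm_nonneg _))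
    by_cases h2 : 2 ≤ |n|
    · obtain ⟨e, D, hw, hint, hD, hC⟩ :=
        exists_weightFun_Ioc_bound hμ hδ0 hδone hδS hη hη_range h2
      obtain ⟨hb, hle⟩ := hw.supNIoi_add_hoel_le hδ0 hint hD hf hL hbdd
        (g := Lminus μ η n f) fun β hβ => by rw [Lminus_eq_neg_oscOp h2 f hβ, norm_neg]
      refine ⟨hb, hle.trans (mul_le_mul_of_nonneg_right (hC.trans ?_) hnn)⟩
      exact mul_le_mul_of_nonneg_right (le_max_left _ _) (by positivity)
    · obtain ⟨e, D, hw, hint, hD, hC⟩ :=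
        exists_weightFun_Ioi_bound hμ hδ0 hδone hη hη_range (habs n hn h2)
      obtain ⟨hb, hle⟩ := hw.supNIoi_add_hoel_le hδ0 hint hD hf hL hbdd
        (g := Lminus μ η n f) fun β hβ => by rw [Lminus_eq_oscOp h2 f hβ]
      refine ⟨hb, hle.trans (mul_le_mul_of_nonneg_right (hC.trans ?_) hnn)⟩
      exact mul_le_mul_of_nonneg_right (le_max_right _ _) (by positivity)
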